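/- arXiv:2307.00473 — 11 statements merged into one kernel-verified Lean document; each statement's English description precedes it below -/
import Mathlib

section
/- Let K₊ and K₋ be invertible diagonal N×N complex matrices and let Φ₊, Φ₋, Ψ₊, Ψ₋ be N×N complex matrices satisfying Φ₊ᵀK₋Ψ₊ − Ψ₊ᵀK₋Φ₊ = 0, Φ₊ᵀK₋Φ₋ − Ψ₊ᵀK₋Ψ₋ = K₊, and Φ₋ᵀK₋Ψ₋ − Ψ₋ᵀK₋Φ₋ = 0. Then also Φ₊K₊⁻¹Ψ₋ᵀ − Ψ₋K₊⁻¹Φ₊ᵀ = 0, Φ₊K₊⁻¹Φ₋ᵀ − Ψ₋K₊⁻¹Ψ₊ᵀ = K₋⁻¹, and Φ₋K₊⁻¹Ψ₊ᵀ − Ψ₊K₊⁻¹Φ₋ᵀ = 0. -/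
open Matrix

/-- From the first triple of Wronskian identities among the transition
matrices Φ±, Ψ± one deduces the second (transposed) triple. -/
theorem transition_matrix_dual_identities (N : ℕ)
    (Kp Km : Matrix (Fin N) (Fin N) ℂ)
    (hKpdiag : Kp.IsDiag) (hKmdiag : Km.IsDiag)
    (hKpunit : IsUnit Kp.det) (hKmunit : IsUnit Km.det)
    (Φp Φm Ψp Ψm : Matrix (Fin N) (Fin N) ℂ)
    (h1 : Φpᵀ * Km * Ψp - Ψpᵀ * Km * Φp = 0)
    (h2 : Φpᵀ * Km * Φm - Ψpᵀ * Km * Ψm = Kp)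
    (h3 : Φmᵀ * Km * Ψm - Ψmᵀ * Km * Φm = 0) :
    Φp * Kp⁻¹ * Ψmᵀ - Ψm * Kp⁻¹ * Φpᵀ = 0 ∧
    Φp * Kp⁻¹ * Φmᵀ - Ψm * Kp⁻¹ * Ψpᵀ = Km⁻¹ ∧
    Φm * Kp⁻¹ * Ψpᵀ - Ψp * Kp⁻¹ * Φmᵀ = 0 := by
  have hKpT : Kpᵀ = Kp := hKpdiag.isSymm
  have hKmT : Kmᵀ = Km := hKmdiag.isSymm
  have h2T : Φmᵀ * Km * Φp - Ψmᵀ * Km * Ψp = Kp := by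
    simpa [transpose_sub, transpose_mul, hKpT, hKmT, Matrix.mul_assoc] using
      congrArg transpose h2
  have hleft : fromBlocks (Kp⁻¹ * (Φpᵀ * Km)) (-(Kp⁻¹ * (Ψpᵀ * Km)))
      (-(Kp⁻¹ * (Ψmᵀ * Km))) (Kp⁻¹ * (Φmᵀ * Km)) * fromBlocks Φm Ψp Ψm Φp = 1 := by
    rw [fromBlocks_multiply, ← fromBlocks_one, fromBlocks_inj]
    have hinv := nonsing_inv_mul Kp hKpunit
    refine ⟨?_, ?_, ?_, ?_⟩
    · refine Eq.trans ?_ ((congrArg (Kp⁻¹ * ·) h2).trans hinv); noncomm_ring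
    · rw [← Matrix.mul_zero Kp⁻¹, ← h1]; noncomm_ring
    · rw [← Matrix.mul_zero Kp⁻¹, ← h3]; noncomm_ring
    · refine Eq.trans ?_ ((congrArg (Kp⁻¹ * ·) h2T).trans hinv); noncomm_ring
  have hright := mul_eq_one_comm.mp hleft
  rw [fromBlocks_multiply, ← fromBlocks_one, fromBlocks_inj] at hright
  obtain ⟨-, h12, h21, h22⟩ := hright
  have cancel : ∀ X : Matrix (Fin N) (Fin N) ℂ, X * Km = 0 → X = 0 := fun X hX => by
    rw [← mul_nonsing_inv_cancel_right Km X hKmunit, hX, Matrix.zero_mul]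
  refine ⟨cancel _ ?_, (inv_eq_left_inv ?_).symm, cancel _ ?_⟩
  · rw [← neg_eq_zero, ← h21]; noncomm_ring
  · rw [← h22]; noncomm_ring
  · rw [← neg_eq_zero, ← h12]; noncomm_ring
end

section
/- Let K₊ and K₋ be invertible diagonal N×N complex matrices, and let Φ₊, Φ₋, Ψ₊, Ψ₋ be N×N complex matrices satisfying the transition-matrix identities Φ₊ᵀK₋Ψ₊ − Ψ₊ᵀK₋Φ₊ = 0, Φ₊ᵀK₋Φ₋ − Ψ₊ᵀK₋Ψ₋ = K₊, Φ₋ᵀK₋Ψ₋ − Ψ₋ᵀK₋Φ₋ = 0, Φ₊K₊⁻¹Ψ₋ᵀ − Ψ₋K₊⁻¹Φ₊ᵀ = 0, Φ₊K₊⁻¹Φ₋ᵀ − Ψ₋K₊⁻¹Ψ₊ᵀ = K₋⁻¹, Φ₋K₊⁻¹Ψ₊ᵀ − Ψ₊K₊⁻¹Φ₋ᵀ = 0, with Φ₊ invertible. Define t₁ := Φ₊⁻¹, r₁ := Ψ₊Φ₊⁻¹, t₂ := Φ₋ − Ψ₊Φ₊⁻¹Ψ₋, r₂ := −Φ₊⁻¹Ψ₋.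 Then the symmetry relations hold: K₋t₂ = t₁ᵀK₊, K₋r₁ = r₁ᵀK₋, and K₊r₂ = r₂ᵀK₊. -/
open Matrix

/-- Symmetry relations for the transmission and reflection matrices
t₁ = Φ₊⁻¹, r₁ = Ψ₊Φ₊⁻¹, t₂ = Φ₋ − Ψ₊Φ₊⁻¹Ψ₋, r₂ = −Φ₊⁻¹Ψ₋. -/
theorem symmetry_relations_transmission_reflection (N : ℕ)
    (Kp Km : Matrix (Fin N) (Fin N) ℂ)
    (hKpdiag : Kp.IsDiag) (hKmdiag : Km.IsDiag)
    (hKpunit : IsUnit Kp.det) (hKmunit : IsUnit Km.det)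
    (Φp Φm Ψp Ψm : Matrix (Fin N) (Fin N) ℂ)
    (hΦp : IsUnit Φp.det)
    (h1 : Φpᵀ * Km * Ψp - Ψpᵀ * Km * Φp = 0)
    (h2 : Φpᵀ * Km * Φm - Ψpᵀ * Km * Ψm = Kp)
    (h3 : Φmᵀ * Km * Ψm - Ψmᵀ * Km * Φm = 0)
    (h4 : Φp * Kp⁻¹ * Ψmᵀ - Ψm * Kp⁻¹ * Φpᵀ = 0)
    (h5 : Φp * Kp⁻¹ * Φmᵀ - Ψm * Kp⁻¹ * Ψpᵀ = Km⁻¹)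
    (h6 : Φm * Kp⁻¹ * Ψpᵀ - Ψp * Kp⁻¹ * Φmᵀ = 0)
    (t1 r1 t2 r2 : Matrix (Fin N) (Fin N) ℂ)
    (ht1 : t1 = Φp⁻¹) (hr1 : r1 = Ψp * Φp⁻¹)
    (ht2 : t2 = Φm - Ψp * Φp⁻¹ * Ψm) (hr2 : r2 = -(Φp⁻¹ * Ψm)) :
    Km * t2 = t1ᵀ * Kp ∧ Km * r1 = r1ᵀ * Km ∧ Kp * r2 = r2ᵀ * Kp := by
  have hAt : Φpᵀ⁻¹ * Φpᵀ = 1 := nonsing_inv_mul _ (by rwa [det_transpose])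
  have hAt' : Φpᵀ * Φpᵀ⁻¹ = 1 := mul_nonsing_inv _ (by rwa [det_transpose])
  have hA : Φp * Φp⁻¹ = 1 := mul_nonsing_inv _ hΦp
  have hA' : Φp⁻¹ * Φp = 1 := nonsing_inv_mul _ hΦp
  have hK : Kp * Kp⁻¹ = 1 := mul_nonsing_inv _ hKpunit
  have hK' : Kp⁻¹ * Kp = 1 := nonsing_inv_mul _ hKpunit
  have reflection : Km * (Ψp * Φp⁻¹) = Φpᵀ⁻¹ * Ψpᵀ * Km := by
    calc Km * (Ψp * Φp⁻¹)
        = (Φpᵀ⁻¹ * Φpᵀ) * Km * Ψp * Φp⁻¹ := by rw [hAt]; noncomm_ring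
      _ = Φpᵀ⁻¹ * (Φpᵀ * Km * Ψp) * Φp⁻¹ := by noncomm_ring
      _ = Φpᵀ⁻¹ * Ψpᵀ * Km * (Φp * Φp⁻¹) := by rw [sub_eq_zero.mp h1]; noncomm_ring
      _ = Φpᵀ⁻¹ * Ψpᵀ * Km := by rw [hA, mul_one]
  subst ht1 hr1 ht2 hr2
  simp only [transpose_neg, transpose_mul, transpose_nonsing_inv]
  refine ⟨?_, reflection, ?_⟩
  · calc Km * (Φm - Ψp * Φp⁻¹ * Ψm)
        = 1 * Km * Φm - Km * (Ψp * Φp⁻¹) * Ψm := by noncomm_ring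
      _ = Φpᵀ⁻¹ * (Φpᵀ * Km * Φm - Ψpᵀ * Km * Ψm) := by
          rw [reflection, ← hAt]; noncomm_ring
      _ = Φpᵀ⁻¹ * Kp := by rw [h2]
  · rw [mul_neg, neg_mul, neg_inj]
    calc Kp * (Φp⁻¹ * Ψm)
        = Kp * Φp⁻¹ * Ψm * (Kp⁻¹ * Kp) := by rw [hK']; noncomm_ring
      _ = Kp * Φp⁻¹ * Ψm * Kp⁻¹ * (Φpᵀ * Φpᵀ⁻¹) * Kp := by rw [hAt']; noncomm_ring
      _ = Kp * Φp⁻¹ * (Ψm * Kp⁻¹ * Φpᵀ) * Φpᵀ⁻¹ * Kp := by noncomm_ring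
      _ = Kp * (Φp⁻¹ * Φp) * Kp⁻¹ * Ψmᵀ * Φpᵀ⁻¹ * Kp := by
          rw [← sub_eq_zero.mp h4]; noncomm_ring
      _ = Ψmᵀ * Φpᵀ⁻¹ * Kp := by rw [hA', mul_one, hK, one_mul]
end

section
/- Let K₊ and K₋ be invertible diagonal N×N complex matrices, and let Φ₊, Φ₋, Ψ₊, Ψ₋ be N×N complex matrices satisfying the transition-matrix identities Φ₊ᵀK₋Ψ₊ − Ψ₊ᵀK₋Φ₊ = 0, Φ₊ᵀK₋Φ₋ − Ψ₊ᵀK₋Ψ₋ = K₊, Φ₋ᵀK₋Ψ₋ − Ψ₋ᵀK₋Φ₋ = 0, Φ₊K₊⁻¹Ψ₋ᵀ − Ψ₋K₊⁻¹Φ₊ᵀ = 0, Φ₊K₊⁻¹Φ₋ᵀ − Ψ₋K₊⁻¹Ψ₊ᵀ = K₋⁻¹, Φ₋K₊⁻¹Ψ₊ᵀ − Ψ₊K₊⁻¹Φ₋ᵀ = 0, with Φ₊ invertible. Let S := [[t₁, r₂],[r₁, t₂]] be the 2N×2N block scattering matrix with t₁ := Φ₊⁻¹, r₁ := Ψ₊Φ₊⁻¹,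 t₂ := Φ₋ − Ψ₊Φ₊⁻¹Ψ₋, r₂ := −Φ₊⁻¹Ψ₋. Then [[0, K₋],[K₊, 0]] · S = Sᵀ · [[0, K₊],[K₋, 0]]. -/
open Matrix

/-- First symmetry of the block scattering matrix
S = [[t₁, r₂],[r₁, t₂]]:  [[0,K₋],[K₊,0]]·S = Sᵀ·[[0,K₊],[K₋,0]]. -/
theorem S_matrix_first_symmetry (N : ℕ)
    (Kp Km : Matrix (Fin N) (Fin N) ℂ)
    (hKpdiag : Kp.IsDiag) (hKmdiag : Km.IsDiag)
    (hKpunit : IsUnit Kp.det) (hKmunit : IsUnit Km.det)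
    (Φp Φm Ψp Ψm : Matrix (Fin N) (Fin N) ℂ)
    (hΦp : IsUnit Φp.det)
    (h1 : Φpᵀ * Km * Ψp - Ψpᵀ * Km * Φp = 0)
    (h2 : Φpᵀ * Km * Φm - Ψpᵀ * Km * Ψm = Kp)
    (h3 : Φmᵀ * Km * Ψm - Ψmᵀ * Km * Φm = 0)
    (h4 : Φp * Kp⁻¹ * Ψmᵀ - Ψm * Kp⁻¹ * Φpᵀ = 0)
    (h5 : Φp * Kp⁻¹ * Φmᵀ - Ψm * Kp⁻¹ * Ψpᵀ = Km⁻¹)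
    (h6 : Φm * Kp⁻¹ * Ψpᵀ - Ψp * Kp⁻¹ * Φmᵀ = 0)
    (S : Matrix (Fin N ⊕ Fin N) (Fin N ⊕ Fin N) ℂ)
    (hS : S = Matrix.fromBlocks (Φp⁻¹) (-(Φp⁻¹ * Ψm)) (Ψp * Φp⁻¹) (Φm - Ψp * Φp⁻¹ * Ψm)) :
    Matrix.fromBlocks 0 Km Kp 0 * S = Sᵀ * Matrix.fromBlocks 0 Kp Km 0 := by
  have hKpT : Kpᵀ = Kp := hKpdiag.isSymm
  have hKmT : Kmᵀ = Km := hKmdiag.isSymm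
  have hΦpT : IsUnit Φpᵀ.det := by rwa [det_transpose]
  have reflection₁ : Km * (Ψp * Φp⁻¹) = (Ψp * Φp⁻¹)ᵀ * Km := by
    calc Km * (Ψp * Φp⁻¹) = Φpᵀ⁻¹ * (Φpᵀ * Km * Ψp) * Φp⁻¹ := by
          simp only [Matrix.mul_assoc, nonsing_inv_mul_cancel_left _ _ hΦpT]
      _ = Φpᵀ⁻¹ * (Ψpᵀ * Km * Φp) * Φp⁻¹ := by rw [sub_eq_zero.mp h1]
      _ = (Ψp * Φp⁻¹)ᵀ * Km := by
          simp only [transpose_mul, transpose_nonsing_inv, Matrix.mul_assoc,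
            mul_nonsing_inv _ hΦp, Matrix.mul_one]
  have transmission : Km * (Φm - Ψp * Φp⁻¹ * Ψm) = (Φp⁻¹)ᵀ * Kp := by
    calc Km * (Φm - Ψp * Φp⁻¹ * Ψm) = Km * Φm - Km * (Ψp * Φp⁻¹) * Ψm := by
          simp only [Matrix.mul_sub, Matrix.mul_assoc]
      _ = Φpᵀ⁻¹ * (Φpᵀ * Km * Φm - Ψpᵀ * Km * Ψm) := by
          rw [reflection₁]
          simp only [transpose_mul, transpose_nonsing_inv, Matrix.mul_sub, Matrix.mul_assoc,
            nonsing_inv_mul_cancel_left _ _ hΦpT]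
      _ = (Φp⁻¹)ᵀ * Kp := by rw [h2, transpose_nonsing_inv]
  have reflection₂ : Kp * (Φp⁻¹ * Ψm) = (Φp⁻¹ * Ψm)ᵀ * Kp := by
    calc Kp * (Φp⁻¹ * Ψm) = Kp * Φp⁻¹ * (Ψm * Kp⁻¹ * Φpᵀ) * Φpᵀ⁻¹ * Kp := by
          simp only [Matrix.mul_assoc, mul_nonsing_inv_cancel_left _ _ hΦpT,
            nonsing_inv_mul _ hKpunit, Matrix.mul_one]
      _ = Kp * Φp⁻¹ * (Φp * Kp⁻¹ * Ψmᵀ) * Φpᵀ⁻¹ * Kp := by rw [sub_eq_zero.mp h4]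
      _ = (Φp⁻¹ * Ψm)ᵀ * Kp := by
          simp only [transpose_mul, transpose_nonsing_inv, Matrix.mul_assoc,
            nonsing_inv_mul_cancel_left _ _ hΦp, mul_nonsing_inv_cancel_left _ _ hKpunit]
  have transmission' : Kp * Φp⁻¹ = (Φm - Ψp * Φp⁻¹ * Ψm)ᵀ * Km := by
    have h := congrArg transpose transmission
    rw [transpose_mul, transpose_mul, transpose_transpose, hKpT, hKmT] at h
    exact h.symm
  rw [hS, fromBlocks_transpose, fromBlocks_multiply, fromBlocks_multiply]
  simp only [Matrix.zero_mul, Matrix.mul_zero, zero_add, add_zero, transpose_neg, neg_zero,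
    Matrix.mul_neg, Matrix.neg_mul]
  rw [reflection₁, transmission, reflection₂, transmission']
end

section
/- Let K₊ and K₋ be invertible diagonal N×N complex matrices, and let Φ₊, Φ₋, Ψ₊, Ψ₋ be N×N complex matrices with both Φ₊ and Φ₋ invertible, satisfying the transition-matrix identities Φ₊ᵀK₋Ψ₊ − Ψ₊ᵀK₋Φ₊ = 0, Φ₊ᵀK₋Φ₋ − Ψ₊ᵀK₋Ψ₋ = K₊, Φ₋ᵀK₋Ψ₋ − Ψ₋ᵀK₋Φ₋ = 0, Φ₊K₊⁻¹Ψ₋ᵀ − Ψ₋K₊⁻¹Φ₊ᵀ = 0, Φ₊K₊⁻¹Φ₋ᵀ − Ψ₋K₊⁻¹Ψ₊ᵀ = K₋⁻¹, Φ₋K₊⁻¹Ψ₊ᵀ − Ψ₊K₊⁻¹Φ₋ᵀ = 0. Define S := [[Φ₊⁻¹, −Φ₊⁻¹Ψ₋],[Ψ₊Φ₊⁻¹, Φ₋ − Ψ₊Φ₊⁻¹Ψ₋]] and the barred matrix S̄ := [[Φ₋⁻¹, −Φ₋⁻¹Ψ₊],[Ψ₋Φ₋⁻¹, Φ₊ −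 Ψ₋Φ₋⁻¹Ψ₊]]. Then S̄ᵀ · [[K₊, 0],[0, K₋]] · S = [[K₋, 0],[0, K₊]]. -/
open Matrix

/-- The scattering matrix carries the data `(Φp a + Ψm b, b)` to `(a, Ψp a + Φm b)`. -/
theorem scattering_mul_fromBlocks {n R : Type*} [Fintype n] [DecidableEq n] [CommRing R]
    {Φp : Matrix n n R} (hΦp : IsUnit Φp.det) (Φm Ψp Ψm : Matrix n n R) :
    Matrix.fromBlocks (Φp⁻¹) (-(Φp⁻¹ * Ψm)) (Ψp * Φp⁻¹) (Φm - Ψp * Φp⁻¹ * Ψm) *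
      Matrix.fromBlocks Φp Ψm 0 1 = Matrix.fromBlocks 1 0 Ψp Φm := by
  simp [Matrix.fromBlocks_multiply, Matrix.mul_assoc, Matrix.nonsing_inv_mul _ hΦp]

theorem isUnit_fromBlocks_zero_one {n R : Type*} [Fintype n] [DecidableEq n] [CommRing R]
    {A : Matrix n n R} (hA : IsUnit A.det) (B : Matrix n n R) :
    IsUnit (Matrix.fromBlocks A B 0 (1 : Matrix n n R)) := by
  simpa [Matrix.isUnit_iff_isUnit_det, Matrix.det_fromBlocks_zero₂₁] using hA

/-- The relation S̄ᵀ·[[K₊,0],[0,K₋]]·S = [[K₋,0],[0,K₊]] between the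
scattering matrix S and the barred scattering matrix S̄ (obtained by Φ₊ ↔ Φ₋, Ψ₊ ↔ Ψ₋). -/
theorem S_matrix_bar_symmetry (N : ℕ)
    (Kp Km : Matrix (Fin N) (Fin N) ℂ)
    (hKpdiag : Kp.IsDiag) (hKmdiag : Km.IsDiag)
    (hKpunit : IsUnit Kp.det) (hKmunit : IsUnit Km.det)
    (Φp Φm Ψp Ψm : Matrix (Fin N) (Fin N) ℂ)
    (hΦp : IsUnit Φp.det) (hΦm : IsUnit Φm.det)
    (h1 : Φpᵀ * Km * Ψp - Ψpᵀ * Km * Φp = 0)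
    (h2 : Φpᵀ * Km * Φm - Ψpᵀ * Km * Ψm = Kp)
    (h3 : Φmᵀ * Km * Ψm - Ψmᵀ * Km * Φm = 0)
    (h4 : Φp * Kp⁻¹ * Ψmᵀ - Ψm * Kp⁻¹ * Φpᵀ = 0)
    (h5 : Φp * Kp⁻¹ * Φmᵀ - Ψm * Kp⁻¹ * Ψpᵀ = Km⁻¹)
    (h6 : Φm * Kp⁻¹ * Ψpᵀ - Ψp * Kp⁻¹ * Φmᵀ = 0)
    (S Sbar : Matrix (Fin N ⊕ Fin N) (Fin N ⊕ Fin N) ℂ)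
    (hS : S = Matrix.fromBlocks (Φp⁻¹) (-(Φp⁻¹ * Ψm)) (Ψp * Φp⁻¹) (Φm - Ψp * Φp⁻¹ * Ψm))
    (hSbar : Sbar =
      Matrix.fromBlocks (Φm⁻¹) (-(Φm⁻¹ * Ψp)) (Ψm * Φm⁻¹) (Φp - Ψm * Φm⁻¹ * Ψp)) :
    Sbarᵀ * Matrix.fromBlocks Kp 0 0 Km * S = Matrix.fromBlocks Km 0 0 Kp := by
  have hKp : Kpᵀ = Kp := hKpdiag.isSymm
  have hKm : Kmᵀ = Km := hKmdiag.isSymm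
  have h2' : Φmᵀ * Km * Φp - Ψmᵀ * Km * Ψp = Kp := by
    simpa [hKp, hKm, Matrix.mul_assoc] using congrArg Matrix.transpose h2
  have hST := scattering_mul_fromBlocks hΦp Φm Ψp Ψm
  have hSbarT := scattering_mul_fromBlocks hΦm Φp Ψm Ψp
  rw [← hS] at hST
  rw [← hSbar] at hSbarT
  have hT := isUnit_fromBlocks_zero_one hΦp Ψm
  have hTbar : IsUnit (Matrix.fromBlocks Φm Ψp 0 1)ᵀ :=
    (Matrix.isUnit_transpose _).mpr (isUnit_fromBlocks_zero_one hΦm Ψp)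
  apply hTbar.mul_left_cancel
  apply hT.mul_right_cancel
  calc
    _ = (Sbar * Matrix.fromBlocks Φm Ψp 0 1)ᵀ * Matrix.fromBlocks Kp 0 0 Km *
          (S * Matrix.fromBlocks Φp Ψm 0 1) := by
      simp only [Matrix.transpose_mul, Matrix.mul_assoc]
    _ = _ := by
      rw [hST, hSbarT]
      simp only [Matrix.fromBlocks_transpose, Matrix.fromBlocks_multiply, Matrix.transpose_one,
        Matrix.transpose_zero, Matrix.mul_zero, Matrix.zero_mul, Matrix.mul_one, Matrix.one_mul,
        add_zero, zero_add]
      rw [sub_eq_zero.mp h1, sub_eq_zero.mp h3, sub_eq_iff_eq_add.mp h2,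
        sub_eq_iff_eq_add.mp h2', add_comm Kp (Ψpᵀ * Km * Ψm)]
end

section
/- (Unitarity of the S-matrix when all scattering channels are open.) Let K₊ and K₋ be real diagonal N×N matrices with strictly positive diagonal entries, and let Φ₊, Φ₋, Ψ₊, Ψ₋ be N×N complex matrices with Φ₋ = conj(Φ₊) and Ψ₋ = conj(Ψ₊) (entrywise complex conjugation), Φ₊ invertible, satisfying the transition-matrix identities Φ₊ᵀK₋Ψ₊ − Ψ₊ᵀK₋Φ₊ = 0, Φ₊ᵀK₋Φ₋ − Ψ₊ᵀK₋Ψ₋ = K₊, Φ₋ᵀK₋Ψ₋ − Ψ₋ᵀK₋Φ₋ = 0, Φ₊K₊⁻¹Ψ₋ᵀ − Ψ₋K₊⁻¹Φ₊ᵀ = 0, Φ₊K₊⁻¹Φ₋ᵀ − Ψ₋K₊⁻¹Ψ₊ᵀ = K₋⁻¹, Φ₋K₊⁻¹Ψ₊ᵀ − Ψ₊K₊⁻¹Φ₋ᵀ = 0. Define S := [[Φ₊⁻¹, −Φ₊⁻¹Ψ₋],[Ψ₊Φ₊⁻¹, Φ₋ − Ψ₊Φ₊⁻¹Ψ₋]].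 Then S† · [[K₊, 0],[0, K₋]] · S = [[K₋, 0],[0, K₊]], where † denotes conjugate transpose. -/
open Matrix

/-- Unitarity of the S-matrix when all scattering channels are open:
if K± are real positive diagonal, Φ₋ = conj Φ₊, Ψ₋ = conj Ψ₊, then
S†·[[K₊,0],[0,K₋]]·S = [[K₋,0],[0,K₊]]. -/
theorem S_matrix_unitary_all_channels_open (N : ℕ)
    (kp km : Fin N → ℝ) (hkp : ∀ i, 0 < kp i) (hkm : ∀ i, 0 < km i)
    (Kp Km : Matrix (Fin N) (Fin N) ℂ)
    (hKp : Kp = Matrix.diagonal fun i => (kp i : ℂ))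
    (hKm : Km = Matrix.diagonal fun i => (km i : ℂ))
    (Φp Φm Ψp Ψm : Matrix (Fin N) (Fin N) ℂ)
    (hconjΦ : Φm = Φp.map (starRingEnd ℂ))
    (hconjΨ : Ψm = Ψp.map (starRingEnd ℂ))
    (hΦp : IsUnit Φp.det)
    (h1 : Φpᵀ * Km * Ψp - Ψpᵀ * Km * Φp = 0)
    (h2 : Φpᵀ * Km * Φm - Ψpᵀ * Km * Ψm = Kp)
    (h3 : Φmᵀ * Km * Ψm - Ψmᵀ * Km * Φm = 0)
    (h4 : Φp * Kp⁻¹ * Ψmᵀ - Ψm * Kp⁻¹ * Φpᵀ = 0)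
    (h5 : Φp * Kp⁻¹ * Φmᵀ - Ψm * Kp⁻¹ * Ψpᵀ = Km⁻¹)
    (h6 : Φm * Kp⁻¹ * Ψpᵀ - Ψp * Kp⁻¹ * Φmᵀ = 0)
    (S : Matrix (Fin N ⊕ Fin N) (Fin N ⊕ Fin N) ℂ)
    (hS : S = Matrix.fromBlocks (Φp⁻¹) (-(Φp⁻¹ * Ψm)) (Ψp * Φp⁻¹) (Φm - Ψp * Φp⁻¹ * Ψm)) :
    Sᴴ * Matrix.fromBlocks Kp 0 0 Km * S = Matrix.fromBlocks Km 0 0 Kp := by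
  have hΦmH : Φmᴴ = Φpᵀ := by ext i j; simp [hconjΦ]
  have hΨmH : Ψmᴴ = Ψpᵀ := by ext i j; simp [hconjΨ]
  have hΦpH : Φpᴴ = Φmᵀ := by ext i j; simp [hconjΦ]
  have hΨpH : Ψpᴴ = Ψmᵀ := by ext i j; simp [hconjΨ]
  have h2T : Φmᵀ * Km * Φp - Ψmᵀ * Km * Ψp = Kp := by
    simpa [hKp, hKm, Matrix.mul_assoc] using congrArg Matrix.transpose h2
  have hT : IsUnit (Matrix.fromBlocks Φp Ψm 0 (1 : Matrix (Fin N) (Fin N) ℂ)) := by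
    simpa [Matrix.isUnit_iff_isUnit_det] using hΦp
  have hST : S * Matrix.fromBlocks Φp Ψm 0 1 = Matrix.fromBlocks 1 0 Ψp Φm := by
    simp [hS, Matrix.fromBlocks_multiply, Matrix.nonsing_inv_mul _ hΦp,
      Matrix.nonsing_inv_mul_cancel_right _ _ hΦp]
  refine hT.mul_right_cancel (hT.star.mul_left_cancel ?_)
  calc _ = (S * Matrix.fromBlocks Φp Ψm 0 1)ᴴ * Matrix.fromBlocks Kp 0 0 Km *
          (S * Matrix.fromBlocks Φp Ψm 0 1) := by
        simp only [Matrix.star_eq_conjTranspose, Matrix.conjTranspose_mul, Matrix.mul_assoc]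
    _ = _ := by
        rw [hST, Matrix.star_eq_conjTranspose]
        simp only [Matrix.fromBlocks_conjTranspose, Matrix.fromBlocks_multiply, hΦmH, hΨmH,
          hΦpH, hΨpH, Matrix.conjTranspose_one, Matrix.conjTranspose_zero, Matrix.mul_zero,
          Matrix.zero_mul, Matrix.one_mul, Matrix.mul_one, add_zero, zero_add,
          ← Matrix.mul_assoc]
        rw [sub_eq_zero.mp h1, ← sub_eq_zero.mp h3, sub_eq_iff_eq_add.mp h2,
          sub_eq_iff_eq_add.mp h2T, add_comm Kp (Ψpᵀ * Km * Ψm)]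
end

section
/- Let K₊ and K₋ be real diagonal N×N matrices with strictly positive diagonal entries, with K_±^{1/2} their diagonal positive square roots, and let Φ₊, Φ₋, Ψ₊, Ψ₋ be N×N complex matrices with Φ₋ = conj(Φ₊), Ψ₋ = conj(Ψ₊), Φ₊ invertible, satisfying the transition-matrix identities Φ₊ᵀK₋Ψ₊ − Ψ₊ᵀK₋Φ₊ = 0, Φ₊ᵀK₋Φ₋ − Ψ₊ᵀK₋Ψ₋ = K₊, Φ₋ᵀK₋Ψ₋ − Ψ₋ᵀK₋Φ₋ = 0, Φ₊K₊⁻¹Ψ₋ᵀ − Ψ₋K₊⁻¹Φ₊ᵀ = 0, Φ₊K₊⁻¹Φ₋ᵀ − Ψ₋K₊⁻¹Ψ₊ᵀ = K₋⁻¹, Φ₋K₊⁻¹Ψ₊ᵀ − Ψ₊K₊⁻¹Φ₋ᵀ = 0. Define Φ̃_± := K₋^{1/2}Φ_±K₊^{−1/2}, Ψ̃_± := K₋^{1/2}Ψ_±K₊^{−1/2} and S̃ := [[Φ̃₊⁻¹, −Φ̃₊⁻¹Ψ̃₋],[Ψ̃₊Φ̃₊⁻¹, Φ̃₋ − Ψ̃₊Φ̃₊⁻¹Ψ̃₋]].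 Then S̃†S̃ = 1 (the 2N×2N identity), i.e. the normalized S-matrix is unitary. -/
open Matrix

/-- A block matrix built from `A` and `B` as a scattering matrix is built from transition matrices
is unitary, if `A` and `B` satisfy the Wronskian relations with unit momenta. -/
theorem conjTranspose_mul_self_fromBlocks_eq_one {n : Type*} [Fintype n] [DecidableEq n]
    {A B : Matrix n n ℂ} (hA : IsUnit A.det)
    (h1 : Aᵀ * B = Bᵀ * A) (h2 : Aᵀ * Aᴴᵀ - Bᵀ * Bᴴᵀ = 1)
    (h4 : A * Bᴴ = Bᴴᵀ * Aᵀ) (h5 : A * Aᴴ - Bᴴᵀ * Bᵀ = 1) :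
    (fromBlocks A⁻¹ (-(A⁻¹ * Bᴴᵀ)) (B * A⁻¹) (Aᴴᵀ - B * A⁻¹ * Bᴴᵀ))ᴴ *
      fromBlocks A⁻¹ (-(A⁻¹ * Bᴴᵀ)) (B * A⁻¹) (Aᴴᵀ - B * A⁻¹ * Bᴴᵀ) = 1 := by
  obtain ⟨C, hC⟩ : ∃ C, C = A⁻¹ := ⟨_, rfl⟩
  have hAC : A * C = 1 := hC ▸ mul_nonsing_inv A hA
  have hCA : C * A = 1 := hC ▸ nonsing_inv_mul A hA
  have hCAt : Cᵀ * Aᵀ = 1 := by rw [← transpose_mul, hAC, transpose_one]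
  have hACt : Aᵀ * Cᵀ = 1 := by rw [← transpose_mul, hCA, transpose_one]
  have hCAh : Cᴴ * Aᴴ = 1 := by rw [← conjTranspose_mul, hAC, conjTranspose_one]
  have hCAc : Cᴴᵀ * Aᴴᵀ = 1 := by rw [← transpose_mul, ← conjTranspose_mul, hCA]; simp
  have hBC : B * C = Cᵀ * Bᵀ := by
    calc B * C = Cᵀ * (Aᵀ * B) * C := by rw [← mul_assoc, hCAt, one_mul]
      _ = Cᵀ * Bᵀ * (A * C) := by rw [h1]; simp only [mul_assoc]
      _ = Cᵀ * Bᵀ := by rw [hAC, mul_one]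
  have hCB : C * Bᴴᵀ = Bᴴ * Cᵀ := by
    calc C * Bᴴᵀ = C * (Bᴴᵀ * Aᵀ) * Cᵀ := by simp only [mul_assoc, hACt, mul_one]
      _ = (C * A) * Bᴴ * Cᵀ := by rw [← h4]; simp only [mul_assoc]
      _ = Bᴴ * Cᵀ := by rw [hCA, one_mul]
  have hD : Aᴴᵀ - B * C * Bᴴᵀ = Cᵀ := by
    calc Aᴴᵀ - B * C * Bᴴᵀ = Cᵀ * (Aᵀ * Aᴴᵀ - Bᵀ * Bᴴᵀ) := by
          rw [hBC, mul_sub, ← mul_assoc, hCAt, one_mul, mul_assoc]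
      _ = Cᵀ := by rw [h2, mul_one]
  have h2' : 1 + Bᴴ * B = Aᴴ * A := by
    have h : (Aᵀ * Aᴴᵀ - Bᵀ * Bᴴᵀ)ᵀ = 1 := by rw [h2, transpose_one]
    rw [transpose_sub, transpose_mul, transpose_mul] at h
    simpa using (sub_eq_iff_eq_add.mp h).symm
  have h5' : 1 + B * Bᴴ = Aᴴᵀ * Aᵀ := by
    have h : (A * Aᴴ - Bᴴᵀ * Bᵀ)ᵀ = 1 := by rw [h5, transpose_one]
    rw [transpose_sub, transpose_mul, transpose_mul] at h
    simpa using (sub_eq_iff_eq_add.mp h).symm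
  have h12 : Cᴴ * -(C * Bᴴᵀ) + (B * C)ᴴ * Cᵀ = 0 := by
    rw [hCB, conjTranspose_mul, mul_neg, mul_assoc, neg_add_cancel]
  rw [← hC, hD, fromBlocks_conjTranspose, fromBlocks_multiply, ← fromBlocks_one]
  have hCth : Cᵀᴴ = Cᴴᵀ := rfl
  congr 1
  · calc Cᴴ * C + (B * C)ᴴ * (B * C) = Cᴴ * (1 + Bᴴ * B) * C := by
          rw [conjTranspose_mul]; noncomm_ring
      _ = (Cᴴ * Aᴴ) * (A * C) := by rw [h2']; simp only [mul_assoc]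
      _ = 1 := by rw [hCAh, hAC, one_mul]
  · have h := congrArg conjTranspose h12
    simpa using h
  · calc (-(C * Bᴴᵀ))ᴴ * -(C * Bᴴᵀ) + Cᵀᴴ * Cᵀ = Cᴴᵀ * (1 + B * Bᴴ) * Cᵀ := by
          rw [hCB, conjTranspose_neg, conjTranspose_mul, conjTranspose_conjTranspose, hCth]
          noncomm_ring
      _ = (Cᴴᵀ * Aᴴᵀ) * (Aᵀ * Cᵀ) := by rw [h5']; simp only [mul_assoc]
      _ = 1 := by rw [hCAc, hACt, one_mul]

/-- The normalized S-matrix S̃, built from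
Φ̃± = K₋^{1/2} Φ± K₊^{-1/2}, Ψ̃± = K₋^{1/2} Ψ± K₊^{-1/2}, is unitary: S̃†S̃ = 1
(all channels open). -/
theorem normalized_S_matrix_unitary (N : ℕ)
    (kp km : Fin N → ℝ) (hkp : ∀ i, 0 < kp i) (hkm : ∀ i, 0 < km i)
    (Kp Km : Matrix (Fin N) (Fin N) ℂ)
    (hKp : Kp = Matrix.diagonal fun i => (kp i : ℂ))
    (hKm : Km = Matrix.diagonal fun i => (km i : ℂ))
    (Φp Φm Ψp Ψm : Matrix (Fin N) (Fin N) ℂ)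
    (hconjΦ : Φm = Φp.map (starRingEnd ℂ))
    (hconjΨ : Ψm = Ψp.map (starRingEnd ℂ))
    (hΦp : IsUnit Φp.det)
    (h1 : Φpᵀ * Km * Ψp - Ψpᵀ * Km * Φp = 0)
    (h2 : Φpᵀ * Km * Φm - Ψpᵀ * Km * Ψm = Kp)
    (h3 : Φmᵀ * Km * Ψm - Ψmᵀ * Km * Φm = 0)
    (h4 : Φp * Kp⁻¹ * Ψmᵀ - Ψm * Kp⁻¹ * Φpᵀ = 0)
    (h5 : Φp * Kp⁻¹ * Φmᵀ - Ψm * Kp⁻¹ * Ψpᵀ = Km⁻¹)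
    (h6 : Φm * Kp⁻¹ * Ψpᵀ - Ψp * Kp⁻¹ * Φmᵀ = 0)
    (Kpsqrt Kpsqrtinv Kmsqrt : Matrix (Fin N) (Fin N) ℂ)
    (hKpsqrt : Kpsqrt = Matrix.diagonal fun i => (Real.sqrt (kp i) : ℂ))
    (hKpsqrtinv : Kpsqrtinv = Matrix.diagonal fun i => ((Real.sqrt (kp i))⁻¹ : ℂ))
    (hKmsqrt : Kmsqrt = Matrix.diagonal fun i => (Real.sqrt (km i) : ℂ))
    (Φtp Φtm Ψtp Ψtm : Matrix (Fin N) (Fin N) ℂ)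
    (hΦtp : Φtp = Kmsqrt * Φp * Kpsqrtinv) (hΦtm : Φtm = Kmsqrt * Φm * Kpsqrtinv)
    (hΨtp : Ψtp = Kmsqrt * Ψp * Kpsqrtinv) (hΨtm : Ψtm = Kmsqrt * Ψm * Kpsqrtinv)
    (St : Matrix (Fin N ⊕ Fin N) (Fin N ⊕ Fin N) ℂ)
    (hSt : St = Matrix.fromBlocks (Φtp⁻¹) (-(Φtp⁻¹ * Ψtm)) (Ψtp * Φtp⁻¹)
      (Φtm - Ψtp * Φtp⁻¹ * Ψtm)) :
    Stᴴ * St = 1 := by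
  have hD : Kmsqrt * Kmsqrt = Km := by
    rw [hKmsqrt, hKm, diagonal_mul_diagonal]
    congr 1; ext i
    exact_mod_cast Real.mul_self_sqrt (hkm i).le
  have hEE : Kpsqrtinv * Kpsqrtinv * Kp = 1 := by
    rw [hKpsqrtinv, hKp, diagonal_mul_diagonal, diagonal_mul_diagonal, ← diagonal_one]
    congr 1; ext i
    have h : (Real.sqrt (kp i))⁻¹ * (Real.sqrt (kp i))⁻¹ * kp i = 1 := by
      rw [← mul_inv, Real.mul_self_sqrt (hkp i).le, inv_mul_cancel₀ (hkp i).ne']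
    exact_mod_cast h
  have hE : Kp⁻¹ = Kpsqrtinv * Kpsqrtinv := inv_eq_left_inv hEE
  have hEKE : Kpsqrtinv * Kp * Kpsqrtinv = 1 := by
    rw [mul_eq_one_comm, ← mul_assoc, hEE]
  have hKm_det : IsUnit Km.det := by
    rw [hKm, det_diagonal, isUnit_iff_ne_zero, Finset.prod_ne_zero_iff]
    exact fun i _ => by exact_mod_cast (hkm i).ne'
  have hDKD : Kmsqrt * Km⁻¹ * Kmsqrt = 1 := by
    rw [mul_eq_one_comm, ← mul_assoc, hD, mul_nonsing_inv _ hKm_det]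
  have hDt : Kmsqrtᵀ = Kmsqrt := by rw [hKmsqrt, diagonal_transpose]
  have hEt : Kpsqrtinvᵀ = Kpsqrtinv := by rw [hKpsqrtinv, diagonal_transpose]
  have hDh : Kmsqrtᴴ = Kmsqrt := by
    rw [hKmsqrt, diagonal_conjTranspose]; congr 1; ext i; simp
  have hEh : Kpsqrtinvᴴ = Kpsqrtinv := by
    rw [hKpsqrtinv, diagonal_conjTranspose]; congr 1; ext i; simp
  have hΦ : Φm = Φpᴴᵀ := hconjΦ
  have hΨ : Ψm = Ψpᴴᵀ := hconjΨ
  have hΦt : Φtm = Φtpᴴᵀ := by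
    simp only [hΦtm, hΦtp, hΦ, conjTranspose_mul, transpose_mul, hDh, hEh, hDt, hEt, mul_assoc]
  have hΨt : Ψtm = Ψtpᴴᵀ := by
    simp only [hΨtm, hΨtp, hΨ, conjTranspose_mul, transpose_mul, hDh, hEh, hDt, hEt, mul_assoc]
  have hΦt_det : IsUnit Φtp.det := by
    have hDu : IsUnit Kmsqrt.det :=
      isUnit_det_of_left_inverse (B := Km⁻¹ * Kmsqrt)
        (mul_eq_one_comm.mp (by rwa [← mul_assoc]))
    have hEu : IsUnit Kpsqrtinv.det :=
      isUnit_det_of_left_inverse hEKE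
    rw [hΦtp, det_mul, det_mul]
    exact (hDu.mul hΦp).mul hEu
  have left (X Y : Matrix (Fin N) (Fin N) ℂ) :
      (Kmsqrt * X * Kpsqrtinv)ᵀ * (Kmsqrt * Y * Kpsqrtinv) =
        Kpsqrtinv * (Xᵀ * Km * Y) * Kpsqrtinv := by
    simp only [transpose_mul, hDt, hEt, ← hD, mul_assoc]
  have right (X Y : Matrix (Fin N) (Fin N) ℂ) :
      (Kmsqrt * X * Kpsqrtinv) * (Kmsqrt * Y * Kpsqrtinv)ᵀ =
        Kmsqrt * (X * Kp⁻¹ * Yᵀ) * Kmsqrt := by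
    simp only [transpose_mul, hDt, hEt, hE, mul_assoc]
  have hΦth : Φtpᴴ = Φtmᵀ := by rw [hΦt, transpose_transpose]
  have hΨth : Ψtpᴴ = Ψtmᵀ := by rw [hΨt, transpose_transpose]
  rw [hSt, hΦt, hΨt]
  refine conjTranspose_mul_self_fromBlocks_eq_one hΦt_det ?_ ?_ ?_ ?_
  · rw [hΦtp, hΨtp, left, left, sub_eq_zero.mp h1]
  · rw [← hΦt, ← hΨt, hΦtp, hΨtp, hΦtm, hΨtm, left, left, ← sub_mul, ← mul_sub, h2, hEKE]
  · rw [← hΨt, hΨth, hΦtp, hΨtm, right, right, sub_eq_zero.mp h4]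
  · rw [← hΨt, hΦth, hΦtp, hΦtm, hΨtp, hΨtm, right, right, ← sub_mul, ← mul_sub, h5, hDKD]
end

section
/- Let r_o ≤ l_o, let κ₋ be an l_o×l_o real diagonal matrix with strictly positive, pairwise distinct diagonal entries, and let κ₊ be an r_o×r_o real diagonal matrix with strictly positive diagonal entries. Let t₁ be an r_o×l_o complex matrix with t₁t₁† invertible, and t₂ an l_o×r_o complex matrix with t₂†t₂ invertible, satisfying the symmetry relation κ₋t₂ = t₁ᵀκ₊. Set t₁^∨ := t₁†(t₁t₁†)⁻¹, L₁ := t₁^∨t₁, t₂^∨ := (t₂†t₂)⁻¹t₂†, L₂ := t₂t₂^∨. If (1 − L₁)·conj(t₂) = 0, then L₁ = L₂, L₁ commutes with κ₋, and L₁ is a real diagonal matrix each of whose diagonal entries is 0 or 1. -/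
open Matrix

section Projections

variable {m n : Type*} [Fintype m] [Fintype n]

/-- Two orthogonal projections of the same trace with nested ranges are equal. -/
lemma eq_of_mul_eq_of_trace_eq {P Q : Matrix m m ℂ} (hP : P.IsHermitian) (hQ : Q.IsHermitian)
    (hPP : P * P = P) (hQQ : Q * Q = Q) (hPQ : P * Q = Q) (htr : P.trace = Q.trace) :
    P = Q := by
  have hQP : Q * P = Q := by
    simpa only [conjTranspose_mul, hP.eq, hQ.eq] using congrArg conjTranspose hPQ
  have hsq : (P - Q)ᴴ * (P - Q) = P - Q := by
    rw [conjTranspose_sub, hP.eq, hQ.eq, sub_mul, mul_sub, mul_sub, hPP, hPQ, hQP, hQQ]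
    abel
  open scoped ComplexOrder in
  exact sub_eq_zero.mp <| trace_conjTranspose_mul_self_eq_zero_iff.mp <| by
    rw [hsq, trace_sub, htr, sub_self]

lemma isDiag_of_commute_diagonal [DecidableEq m] {d : m → ℂ} (hd : Function.Injective d)
    {A : Matrix m m ℂ} (h : A * diagonal d = diagonal d * A) : A.IsDiag := by
  intro i j hij
  have hentry := congrFun (congrFun h i) j
  rw [mul_diagonal, diagonal_mul, mul_comm, ← sub_eq_zero, ← sub_mul] at hentry
  exact (mul_eq_zero.mp hentry).resolve_left (sub_ne_zero.mpr (hd.ne hij.symm))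

variable [DecidableEq n]

/-- The matrix `A (Aᴴ A)⁻¹ Aᴴ`, which projects orthogonally onto the column space of `A` when
`Aᴴ A` is invertible. -/
noncomputable def columnProjection (A : Matrix m n ℂ) : Matrix m m ℂ :=
  A * (Aᴴ * A)⁻¹ * Aᴴ

lemma columnProjection_isHermitian (A : Matrix m n ℂ) : (columnProjection A).IsHermitian := by
  simp [IsHermitian, columnProjection, conjTranspose_mul, conjTranspose_nonsing_inv, Matrix.mul_assoc]

lemma columnProjection_mul_self {A : Matrix m n ℂ} (hA : IsUnit (Aᴴ * A).det) :
    columnProjection A * A = A := by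
  rw [columnProjection, Matrix.mul_assoc, Matrix.mul_assoc, nonsing_inv_mul _ hA, Matrix.mul_one]

lemma mul_columnProjection {A : Matrix m n ℂ} {B C : Matrix m m ℂ} (h : B * (C * A) = C * A) :
    B * (C * columnProjection A) = C * columnProjection A := by
  have h' := congrArg (· * ((Aᴴ * A)⁻¹ * Aᴴ)) h
  simpa only [columnProjection, Matrix.mul_assoc] using h'

lemma columnProjection_mul_columnProjection {A : Matrix m n ℂ} (hA : IsUnit (Aᴴ * A).det) :
    columnProjection A * columnProjection A = columnProjection A := by
  have h := congrArg (· * ((Aᴴ * A)⁻¹ * Aᴴ)) (columnProjection_mul_self hA)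
  simpa only [columnProjection, Matrix.mul_assoc] using h

lemma trace_columnProjection {A : Matrix m n ℂ} (hA : IsUnit (Aᴴ * A).det) :
    (columnProjection A).trace = Fintype.card n := by
  rw [columnProjection, trace_mul_comm, ← Matrix.mul_assoc, mul_nonsing_inv _ hA, trace_one]

end Projections

/-- The open-channel projectors L₁ = t₁^∨t₁ and L₂ = t₂t₂^∨ coincide,
commute with κ₋, and are real diagonal matrices with entries 0 or 1. -/
theorem open_channel_projectors (lo ro : ℕ) (hle : ro ≤ lo)
    (km : Fin lo → ℝ) (hkm_pos : ∀ i, 0 < km i) (hkm_inj : Function.Injective km)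
    (kp : Fin ro → ℝ) (hkp_pos : ∀ i, 0 < kp i)
    (κm : Matrix (Fin lo) (Fin lo) ℂ) (hκm : κm = Matrix.diagonal fun i => (km i : ℂ))
    (κp : Matrix (Fin ro) (Fin ro) ℂ) (hκp : κp = Matrix.diagonal fun i => (kp i : ℂ))
    (t1 : Matrix (Fin ro) (Fin lo) ℂ) (t2 : Matrix (Fin lo) (Fin ro) ℂ)
    (ht1 : IsUnit (t1 * t1ᴴ).det) (ht2 : IsUnit (t2ᴴ * t2).det)
    (hsym : κm * t2 = t1ᵀ * κp)
    (t1v : Matrix (Fin lo) (Fin ro) ℂ) (ht1v : t1v = t1ᴴ * (t1 * t1ᴴ)⁻¹)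
    (t2v : Matrix (Fin ro) (Fin lo) ℂ) (ht2v : t2v = (t2ᴴ * t2)⁻¹ * t2ᴴ)
    (L1 L2 : Matrix (Fin lo) (Fin lo) ℂ)
    (hL1 : L1 = t1v * t1) (hL2 : L2 = t2 * t2v)
    (h : (1 - L1) * t2.map (starRingEnd ℂ) = 0) :
    L1 = L2 ∧ L1 * κm = κm * L1 ∧ L1.IsDiag ∧ (∀ i, L1 i i = 0 ∨ L1 i i = 1) := by
  set s : Matrix (Fin lo) (Fin ro) ℂ := t2.map (starRingEnd ℂ) with hs
  have hsH : sᴴ = t2ᵀ := by ext; simp [hs]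
  have hA1 : IsUnit (t1ᴴᴴ * t1ᴴ).det := by rwa [conjTranspose_conjTranspose]
  have hss : sᴴ * s = (t2ᴴ * t2)ᵀ := by
    rw [hsH, transpose_mul]; rfl
  have hA2 : IsUnit (sᴴ * s).det := by rwa [hss, det_transpose]
  have hP1 : L1 = columnProjection t1ᴴ := by
    rw [hL1, ht1v, columnProjection, conjTranspose_conjTranspose]
  have hP2 : L2ᵀ = columnProjection s := by
    rw [hL2, ht2v, columnProjection, hss, hsH, transpose_mul, transpose_mul,
      transpose_nonsing_inv]
    rfl
  have hherm : L1.IsHermitian := hP1 ▸ columnProjection_isHermitian _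
  have hidem : L1 * L1 = L1 := by
    rw [hP1]; exact columnProjection_mul_columnProjection hA1
  have hL1s : L1 * s = s := by
    rw [Matrix.sub_mul, Matrix.one_mul, sub_eq_zero] at h
    exact h.symm
  have hL1P : L1 * columnProjection s = columnProjection s := by
    simpa using mul_columnProjection (B := L1) (C := 1) (A := s) (by simpa using hL1s)
  have heq : L1 = columnProjection s :=
    eq_of_mul_eq_of_trace_eq hherm (columnProjection_isHermitian s) hidem
      (columnProjection_mul_columnProjection hA2) hL1P
      (by rw [hP1, trace_columnProjection hA1, trace_columnProjection hA2])
  have hκs : κm * s = t1ᴴ * κp := by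
    ext i j
    have hentry := congrArg (starRingEnd ℂ) (congrFun (congrFun hsym i) j)
    simpa [hκm, hκp, hs] using hentry
  have hL1κs : L1 * (κm * s) = κm * s := by
    rw [hκs, ← Matrix.mul_assoc, hP1, columnProjection_mul_self hA1]
  have hinv : L1 * (κm * L1) = κm * L1 := by
    have := mul_columnProjection hL1κs
    rwa [← heq] at this
  have hκH : κmᴴ = κm := by
    rw [hκm, diagonal_conjTranspose]
    congr 1
    ext i
    simp
  have hcomm : L1 * κm = κm * L1 := by
    have hadj := congrArg conjTranspose hinv
    simp only [conjTranspose_mul, hherm.eq, hκH] at hadj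
    rw [← hadj, Matrix.mul_assoc, hinv]
  have hdiag : L1.IsDiag :=
    isDiag_of_commute_diagonal (d := fun i => (km i : ℂ))
      (Complex.ofReal_injective.comp hkm_inj) (hκm ▸ hcomm)
  refine ⟨?_, hcomm, hdiag, fun i => ?_⟩
  · rw [← hdiag.isSymm.eq, heq, ← hP2, transpose_transpose]
  · have hentry := congrFun (congrFun hidem i) i
    rw [← hdiag.diagonal_diag, diagonal_mul_diagonal] at hentry
    simp only [diagonal_apply_eq, diag_apply] at hentry
    exact IsIdempotentElem.iff_eq_zero_or_one.mp hentry
end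

section
/- Let κ₋ be an l_o×l_o and κ₊ an r_o×r_o real invertible diagonal matrix. Let t₁ (r_o×l_o), t₂ (l_o×r_o), r₁ (l_o×l_o), r₂ (r_o×r_o) be complex matrices satisfying the symmetry relations κ₋t₂ = t₁ᵀκ₊, κ₋r₁ = r₁ᵀκ₋, κ₊r₂ = r₂ᵀκ₊. If conj(t₁)·r₁ + conj(r₂)·t₁ = 0, then r₁·conj(t₂) + t₂·conj(r₂) = 0. -/
open Matrix

/-- Entrywise conjugation preserves an intertwining relation `D * A = Bᵀ * E` between
real diagonal matrices `D` and `E`. -/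
theorem diagonal_ofReal_mul_map_conj {m n : Type*} [Fintype m] [Fintype n]
    [DecidableEq m] [DecidableEq n] {d : m → ℝ} {e : n → ℝ}
    {A : Matrix m n ℂ} {B : Matrix n m ℂ}
    (h : Matrix.diagonal (fun i => (d i : ℂ)) * A =
      Bᵀ * Matrix.diagonal fun i => (e i : ℂ)) :
    Matrix.diagonal (fun i => (d i : ℂ)) * A.map (starRingEnd ℂ) =
      (B.map (starRingEnd ℂ))ᵀ * Matrix.diagonal fun i => (e i : ℂ) := by
  ext i j
  simpa using congrArg (starRingEnd ℂ) (congrFun (congrFun h i) j)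

/-- From conj(t₁)·r₁ + conj(r₂)·t₁ = 0 and the symmetry relations one
deduces r₁·conj(t₂) + t₂·conj(r₂) = 0. -/
theorem open_channel_relation_transfer (lo ro : ℕ)
    (km : Fin lo → ℝ) (hkm : ∀ i, km i ≠ 0)
    (kp : Fin ro → ℝ) (hkp : ∀ i, kp i ≠ 0)
    (κm : Matrix (Fin lo) (Fin lo) ℂ) (hκm : κm = Matrix.diagonal fun i => (km i : ℂ))
    (κp : Matrix (Fin ro) (Fin ro) ℂ) (hκp : κp = Matrix.diagonal fun i => (kp i : ℂ))
    (t1 : Matrix (Fin ro) (Fin lo) ℂ) (t2 : Matrix (Fin lo) (Fin ro) ℂ)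
    (r1 : Matrix (Fin lo) (Fin lo) ℂ) (r2 : Matrix (Fin ro) (Fin ro) ℂ)
    (hsymt : κm * t2 = t1ᵀ * κp)
    (hsymr1 : κm * r1 = r1ᵀ * κm)
    (hsymr2 : κp * r2 = r2ᵀ * κp)
    (h : t1.map (starRingEnd ℂ) * r1 + r2.map (starRingEnd ℂ) * t1 = 0) :
    r1 * t2.map (starRingEnd ℂ) + t2 * r2.map (starRingEnd ℂ) = 0 := by
  subst hκm hκp
  have hunit : IsUnit (Matrix.diagonal fun i => (km i : ℂ)) := by
    rw [Matrix.isUnit_diagonal, Pi.isUnit_iff]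
    exact fun i => (Complex.ofReal_ne_zero.mpr (hkm i)).isUnit
  have hdet := (Matrix.isUnit_iff_isUnit_det _).mp hunit
  have key : (Matrix.diagonal fun i => (km i : ℂ)) *
      (r1 * t2.map (starRingEnd ℂ) + t2 * r2.map (starRingEnd ℂ)) = 0 := by
    rw [Matrix.mul_add, ← Matrix.mul_assoc, ← Matrix.mul_assoc, hsymr1, hsymt,
      Matrix.mul_assoc, Matrix.mul_assoc, diagonal_ofReal_mul_map_conj hsymt,
      diagonal_ofReal_mul_map_conj hsymr2, ← Matrix.mul_assoc, ← Matrix.mul_assoc,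
      ← Matrix.add_mul, ← Matrix.transpose_mul, ← Matrix.transpose_mul,
      ← Matrix.transpose_add, h, Matrix.transpose_zero, Matrix.zero_mul]
  rw [← Matrix.nonsing_inv_mul_cancel_left _ (r1 * _ + _) hdet, key, Matrix.mul_zero]
end

section
/- Let t₁ be an r_o×l_o complex matrix with t₁t₁† invertible (full row rank), and let t₂ (l_o×r_o), r₁ (l_o×l_o), r₂ (r_o×r_o) be complex matrices satisfying conj(t₁)·r₁ + conj(r₂)·t₁ = 0 and conj(t₂)·t₁ + conj(r₁)·r₁ = 1 (the l_o×l_o identity). Then conj(t₁)·t₂ + conj(r₂)·r₂ = 1 (the r_o×r_o identity). -/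
open Matrix

/-- From conj(t₁)·r₁ + conj(r₂)·t₁ = 0 and conj(t₂)·t₁ + conj(r₁)·r₁ = 1,
with t₁ of full row rank, one deduces conj(t₁)·t₂ + conj(r₂)·r₂ = 1. -/
theorem open_channel_unitarity_step (lo ro : ℕ)
    (t1 : Matrix (Fin ro) (Fin lo) ℂ) (t2 : Matrix (Fin lo) (Fin ro) ℂ)
    (r1 : Matrix (Fin lo) (Fin lo) ℂ) (r2 : Matrix (Fin ro) (Fin ro) ℂ)
    (ht1 : IsUnit (t1 * t1ᴴ).det)
    (h1 : t1.map (starRingEnd ℂ) * r1 + r2.map (starRingEnd ℂ) * t1 = 0)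
    (h2 : t2.map (starRingEnd ℂ) * t1 + r1.map (starRingEnd ℂ) * r1 = 1) :
    t1.map (starRingEnd ℂ) * t2 + r2.map (starRingEnd ℂ) * r2 = 1 := by
  have h1' := congrArg (fun M => M.map (starRingEnd ℂ)) h1
  have conj_conj : ∀ {m n : ℕ} (M : Matrix (Fin m) (Fin n) ℂ),
      (M.map (starRingEnd ℂ)).map (starRingEnd ℂ) = M := fun M => by
    ext i j
    simp
  simp only [Matrix.map_add _ (map_add (starRingEnd ℂ)), Matrix.map_mul, conj_conj,
    Matrix.map_zero _ (map_zero (starRingEnd ℂ))] at h1'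
  have absorb : (t1 * t2.map (starRingEnd ℂ) + r2 * r2.map (starRingEnd ℂ)) * t1 = t1 :=
    calc
      _ = t1 * (t2.map (starRingEnd ℂ) * t1) + r2 * (r2.map (starRingEnd ℂ) * t1) := by
        rw [Matrix.add_mul, Matrix.mul_assoc, Matrix.mul_assoc]
      _ = t1 * (1 - r1.map (starRingEnd ℂ) * r1) + r2 * -(t1.map (starRingEnd ℂ) * r1) := by
        rw [eq_sub_of_add_eq h2, eq_neg_of_add_eq_zero_right h1]
      _ = t1 - (t1 * r1.map (starRingEnd ℂ) + r2 * t1.map (starRingEnd ℂ)) * r1 := by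
        rw [Matrix.mul_sub, Matrix.mul_one, Matrix.mul_neg, Matrix.add_mul, Matrix.mul_assoc,
          Matrix.mul_assoc]
        abel
      _ = t1 := by rw [h1', Matrix.zero_mul, sub_zero]
  have key : t1 * t2.map (starRingEnd ℂ) + r2 * r2.map (starRingEnd ℂ) = 1 := by
    refine ((Matrix.isUnit_iff_isUnit_det _).2 ht1).mul_right_cancel ?_
    rw [← Matrix.mul_assoc, absorb, one_mul]
  have key' := congrArg (fun M => M.map (starRingEnd ℂ)) key
  simpa only [Matrix.map_add _ (map_add (starRingEnd ℂ)), Matrix.map_mul, conj_conj,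
    Matrix.map_one _ (map_zero (starRingEnd ℂ)) (map_one (starRingEnd ℂ))] using key'
end

section
/- (Unitarity of the S-matrix in the subspace of open channels.) Let κ₋ be an l_o×l_o and κ₊ an r_o×r_o real diagonal matrix with strictly positive diagonal entries. Let t₁ (r_o×l_o), t₂ (l_o×r_o), r₁ (l_o×l_o), r₂ (r_o×r_o) be complex matrices satisfying the symmetry relations κ₋t₂ = t₁ᵀκ₊, κ₋r₁ = r₁ᵀκ₋, κ₊r₂ = r₂ᵀκ₊, together with conj(t₁)·r₁ + conj(r₂)·t₁ = 0, conj(t₂)·t₁ + conj(r₁)·r₁ = 1_{l_o}, and conj(t₁)·t₂ + conj(r₂)·r₂ = 1_{r_o}. Then the open-channel scattering matrix S_oo := [[t₁, r₂],[r₁, t₂]] (a block matrix with row blocks of sizes r_o, l_o and column blocks of sizes l_o, r_o) satisfies S_oo† · [[κ₊, 0],[0, κ₋]] · S_oo = [[κ₋, 0],[0, κ₊]]; in components: t₁†κ₊t₁ + r₁†κ₋r₁ = κ₋, t₂†κ₋r₁ + r₂†κ₊t₁ = 0, r₁†κ₋t₂ + t₁†κ₊r₂ = 0, and t₂†κ₋t₂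 + r₂†κ₊r₂ = κ₊. -/
open Matrix

theorem diagonal_ofReal_map_conj {n : Type*} [DecidableEq n] (d : n → ℝ) :
    (diagonal fun i => (d i : ℂ)).map (starRingEnd ℂ) = diagonal fun i => (d i : ℂ) := by
  rw [diagonal_map (map_zero _)]
  simp

theorem conjTranspose_mul_eq_mul_map_conj {m n : Type*} [Fintype m] [Fintype n]
    {K : Matrix m m ℂ} {L : Matrix n n ℂ} {A : Matrix n m ℂ} {B : Matrix m n ℂ}
    (hK : K.map (starRingEnd ℂ) = K) (hL : L.map (starRingEnd ℂ) = L)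
    (h : K * B = Aᵀ * L) : Aᴴ * L = K * B.map (starRingEnd ℂ) := by
  have h' := congrArg (fun M => M.map (starRingEnd ℂ)) h
  simp only [Matrix.map_mul, hK, hL] at h'
  exact h'.symm

/-- Unitarity of the S-matrix in the subspace of open channels:
S_oo† · [[κ₊,0],[0,κ₋]] · S_oo = [[κ₋,0],[0,κ₊]], together with the four component
identities. -/
theorem S_matrix_unitary_open_channels (lo ro : ℕ)
    (km : Fin lo → ℝ) (hkm : ∀ i, 0 < km i)
    (kp : Fin ro → ℝ) (hkp : ∀ i, 0 < kp i)
    (κm : Matrix (Fin lo) (Fin lo) ℂ) (hκm : κm = Matrix.diagonal fun i => (km i : ℂ))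
    (κp : Matrix (Fin ro) (Fin ro) ℂ) (hκp : κp = Matrix.diagonal fun i => (kp i : ℂ))
    (t1 : Matrix (Fin ro) (Fin lo) ℂ) (t2 : Matrix (Fin lo) (Fin ro) ℂ)
    (r1 : Matrix (Fin lo) (Fin lo) ℂ) (r2 : Matrix (Fin ro) (Fin ro) ℂ)
    (hsymt : κm * t2 = t1ᵀ * κp)
    (hsymr1 : κm * r1 = r1ᵀ * κm)
    (hsymr2 : κp * r2 = r2ᵀ * κp)
    (h1 : t1.map (starRingEnd ℂ) * r1 + r2.map (starRingEnd ℂ) * t1 = 0)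
    (h2 : t2.map (starRingEnd ℂ) * t1 + r1.map (starRingEnd ℂ) * r1 = 1)
    (h3 : t1.map (starRingEnd ℂ) * t2 + r2.map (starRingEnd ℂ) * r2 = 1)
    (Soo : Matrix (Fin ro ⊕ Fin lo) (Fin lo ⊕ Fin ro) ℂ)
    (hSoo : Soo = Matrix.fromBlocks t1 r2 r1 t2) :
    Sooᴴ * Matrix.fromBlocks κp 0 0 κm * Soo = Matrix.fromBlocks κm 0 0 κp ∧
    t1ᴴ * κp * t1 + r1ᴴ * κm * r1 = κm ∧
    t2ᴴ * κm * r1 + r2ᴴ * κp * t1 = 0 ∧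
    r1ᴴ * κm * t2 + t1ᴴ * κp * r2 = 0 ∧
    t2ᴴ * κm * t2 + r2ᴴ * κp * r2 = κp := by
  have hm : κm.map (starRingEnd ℂ) = κm := by rw [hκm, diagonal_ofReal_map_conj]
  have hp : κp.map (starRingEnd ℂ) = κp := by rw [hκp, diagonal_ofReal_map_conj]
  have hmT : κmᵀ = κm := by rw [hκm, diagonal_transpose]
  have hpT : κpᵀ = κp := by rw [hκp, diagonal_transpose]
  have hmH : κmᴴ = κm := by rw [conjTranspose, hmT]; exact hm
  have hpH : κpᴴ = κp := by rw [conjTranspose, hpT]; exact hp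
  have hsymt' : κp * t1 = t2ᵀ * κm := by
    have h := congrArg transpose hsymt
    rw [transpose_mul, transpose_mul, transpose_transpose, hmT, hpT] at h
    exact h.symm
  have ht1 := conjTranspose_mul_eq_mul_map_conj hm hp hsymt
  have ht2 := conjTranspose_mul_eq_mul_map_conj hp hm hsymt'
  have hr1 := conjTranspose_mul_eq_mul_map_conj hm hm hsymr1
  have hr2 := conjTranspose_mul_eq_mul_map_conj hp hp hsymr2
  have e1 : t1ᴴ * κp * t1 + r1ᴴ * κm * r1 = κm := by
    rw [ht1, hr1, Matrix.mul_assoc, Matrix.mul_assoc, ← Matrix.mul_add, h2, Matrix.mul_one]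
  have e2 : t2ᴴ * κm * r1 + r2ᴴ * κp * t1 = 0 := by
    rw [ht2, hr2, Matrix.mul_assoc, Matrix.mul_assoc, ← Matrix.mul_add, h1, Matrix.mul_zero]
  have e3 : r1ᴴ * κm * t2 + t1ᴴ * κp * r2 = 0 := by
    simpa [conjTranspose_mul, hmH, hpH, Matrix.mul_assoc] using congrArg conjTranspose e2
  have e4 : t2ᴴ * κm * t2 + r2ᴴ * κp * r2 = κp := by
    rw [ht2, hr2, Matrix.mul_assoc, Matrix.mul_assoc, ← Matrix.mul_add, h3, Matrix.mul_one]
  refine ⟨?_, e1, e2, e3, e4⟩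
  rw [hSoo, fromBlocks_conjTranspose, fromBlocks_multiply, fromBlocks_multiply]
  simp only [Matrix.mul_zero, add_zero, zero_add]
  rw [e1, add_comm (t1ᴴ * κp * r2), e3, add_comm (r2ᴴ * κp * t1), e2,
    add_comm (r2ᴴ * κp * r2), e4]
end

section
/- (No bound states when all scattering channels are open.) Let K₊ and K₋ be real diagonal N×N matrices with strictly positive diagonal entries, and let Φ₊, Φ₋, Ψ₊, Ψ₋ be N×N complex matrices with Ψ₋ = conj(Ψ₊) and satisfying Φ₊ᵀK₋Φ₋ − Ψ₊ᵀK₋Ψ₋ = K₊. Then Φ₊ has trivial kernel: Φ₊v = 0 implies v = 0; in particular Φ₊ is invertible and det Φ₊ ≠ 0. -/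
open Matrix

lemma dotProduct_transpose_mul_mul_mulVec {n R : Type*} [Fintype n] [CommSemiring R]
    (A K B : Matrix n n R) (v w : n → R) :
    v ⬝ᵥ (Aᵀ * K * B) *ᵥ w = (A *ᵥ v) ⬝ᵥ K *ᵥ (B *ᵥ w) := by
  rw [Matrix.mul_assoc, ← mulVec_mulVec, dotProduct_mulVec, vecMul_transpose, ← mulVec_mulVec]

lemma dotProduct_diagonal_mulVec_star {n : Type*} [Fintype n] [DecidableEq n]
    (k : n → ℝ) (w : n → ℂ) :
    w ⬝ᵥ (diagonal fun i => (k i : ℂ)) *ᵥ star w =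
      ((∑ i, k i * Complex.normSq (w i) : ℝ) : ℂ) := by
  simp only [dotProduct, mulVec_diagonal, Pi.star_apply, Complex.ofReal_sum, Complex.ofReal_mul,
    ← Complex.mul_conj, starRingEnd_apply]
  exact Finset.sum_congr rfl fun i _ => by ring

lemma map_conj_mulVec_star {m n : Type*} [Fintype n] (A : Matrix m n ℂ) (v : n → ℂ) :
    A.map (starRingEnd ℂ) *ᵥ star v = star (A *ᵥ v) := by
  ext i
  simp [mulVec, dotProduct]

/-- No bound states when all scattering channels are open: with K± real
positive diagonal, Ψ₋ = conj Ψ₊ and Φ₊ᵀK₋Φ₋ − Ψ₊ᵀK₋Ψ₋ = K₊, the matrix Φ₊ has trivial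
kernel; in particular it is invertible and det Φ₊ ≠ 0. -/
theorem no_bound_states_all_channels_open (N : ℕ)
    (kp km : Fin N → ℝ) (hkp : ∀ i, 0 < kp i) (hkm : ∀ i, 0 < km i)
    (Kp Km : Matrix (Fin N) (Fin N) ℂ)
    (hKp : Kp = Matrix.diagonal fun i => (kp i : ℂ))
    (hKm : Km = Matrix.diagonal fun i => (km i : ℂ))
    (Φp Φm Ψp Ψm : Matrix (Fin N) (Fin N) ℂ)
    (hconjΨ : Ψm = Ψp.map (starRingEnd ℂ))
    (h2 : Φpᵀ * Km * Φm - Ψpᵀ * Km * Ψm = Kp) :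
    (∀ v : Fin N → ℂ, Φp.mulVec v = 0 → v = 0) ∧ IsUnit Φp ∧ Φp.det ≠ 0 := by
  have ker : ∀ v : Fin N → ℂ, Φp.mulVec v = 0 → v = 0 := by
    intro v hv
    have h := congrArg (fun M => v ⬝ᵥ M *ᵥ star v) h2
    simp only [sub_mulVec, dotProduct_sub, dotProduct_transpose_mul_mul_mulVec, hv,
      zero_dotProduct, hconjΨ, map_conj_mulVec_star, hKp, hKm,
      dotProduct_diagonal_mulVec_star] at h
    have hsum : -(∑ i, km i * Complex.normSq ((Ψp *ᵥ v) i)) =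
        ∑ i, kp i * Complex.normSq (v i) := by
      exact_mod_cast (zero_sub _).symm.trans h
    have hnonneg : 0 ≤ ∑ i, km i * Complex.normSq ((Ψp *ᵥ v) i) :=
      Finset.sum_nonneg fun i _ => mul_nonneg (hkm i).le (Complex.normSq_nonneg _)
    have hterm : ∀ i ∈ Finset.univ, 0 ≤ kp i * Complex.normSq (v i) :=
      fun i _ => mul_nonneg (hkp i).le (Complex.normSq_nonneg _)
    have hzero : ∑ i, kp i * Complex.normSq (v i) = 0 :=
      le_antisymm (by linarith) (Finset.sum_nonneg hterm)
    ext i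
    have hi := (Finset.sum_eq_zero_iff_of_nonneg hterm).1 hzero i (Finset.mem_univ i)
    exact Complex.normSq_eq_zero.1 ((mul_eq_zero.1 hi).resolve_left (hkp i).ne')
  have hdet : Φp.det ≠ 0 := fun h0 => by
    obtain ⟨v, hv, hv0⟩ := exists_mulVec_eq_zero_iff.2 h0
    exact hv (ker v hv0)
  exact ⟨ker, (isUnit_iff_isUnit_det Φp).2 hdet.isUnit, hdet⟩
end
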